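/- Let 𝒜 be a C*-algebra over ℍ satisfying the quasicommutativity hypothesis, with scalar embedding φ, and let A ∈ 𝒜 commute with φ(a) for every a ∈ ℍ. Then: (i) if A is normal, then r(A) = ‖A‖; (ii) if A is selfadjoint, then σ(A) is a nonempty compact set consisting of real quaternions (every z ∈ σ(A) has zero imaginary part), and at least one of the real quaternions ‖A‖ or −‖A‖ belongs to σ(A); (iii) if A is unitary, then ‖A‖ = 1 and σ(A) ⊆ {z ∈ ℍ : ‖z‖ = 1}. -/

import Mathlib

local notation "ℍ" => Quaternion ℝ

/-- The ℍ-spectrum of an element `x` of a Banach algebra over ℍ with scalar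
embedding `φ`. -/
def qSpectrum {A : Type*} [NormedRing A] [NormedAlgebra ℝ A]
    (φ : ℍ →ₐ[ℝ] A) (x : A) : Set ℍ :=
  {z : ℍ | ¬ IsUnit (φ z - x)}

/-- The spectral radius `r(x) = sup{‖z‖ : z ∈ σ(x)}` of an element of a Banach
algebra over ℍ. -/
noncomputable def qSpectralRadius {A : Type*} [NormedRing A] [NormedAlgebra ℝ A]
    (φ : ℍ →ₐ[ℝ] A) (x : A) : ℝ :=
  sSup {r : ℝ | ∃ z ∈ qSpectrum φ x, r = ‖z‖}

open Filter Topology in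
/-- In a complex Banach algebra, an element satisfying `‖x ^ 2 ^ n‖ = ‖x‖ ^ 2 ^ n` for all `n` has
a spectral value of modulus `‖x‖`. -/
theorem exists_mem_spectrum_norm_eq {B : Type*} [NormedRing B] [NormedAlgebra ℂ B]
    [CompleteSpace B] [Nontrivial B] (x : B) (hx : ∀ n : ℕ, ‖x ^ 2 ^ n‖₊ = ‖x‖₊ ^ 2 ^ n) :
    ∃ k ∈ spectrum ℂ x, ‖k‖ = ‖x‖ := by
  obtain ⟨k, hk, hkr⟩ := spectrum.exists_nnnorm_eq_spectralRadius x
  refine ⟨k, hk, ?_⟩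
  have hr : spectralRadius ℂ x = (‖x‖₊ : ENNReal) := by
    have hconst : Tendsto (fun _n : ℕ => (‖x‖₊ : ENNReal)) atTop _ := tendsto_const_nhds
    refine tendsto_nhds_unique ?_ hconst
    convert!
      (spectrum.pow_nnnorm_pow_one_div_tendsto_nhds_spectralRadius x).comp
        (tendsto_pow_atTop_atTop_of_one_lt one_lt_two) using 1
    refine funext fun n => ?_
    rw [Function.comp_apply, hx, ENNReal.coe_pow, ← ENNReal.rpow_natCast, ← ENNReal.rpow_mul]
    simp
  rw [hr, ENNReal.coe_inj] at hkr
  exact congrArg NNReal.toReal hkr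

/-- A version of `exists_mem_spectrum_norm_eq` for a real Banach algebra containing a copy of `ℂ`
that commutes with the given element but need not be central. -/
theorem exists_not_isUnit_sub_norm_eq {A : Type*} [NormedRing A] [NormedAlgebra ℝ A]
    [CompleteSpace A] [Nontrivial A] (j : ℂ →ₐ[ℝ] A) (hj : ∀ z, ‖j z‖ = ‖z‖) (a : A)
    (ha : ∀ z, a * j z = j z * a) (hpow : ∀ n : ℕ, ‖a ^ 2 ^ n‖₊ = ‖a‖₊ ^ 2 ^ n) :
    ∃ k : ℂ, ¬ IsUnit (j k - a) ∧ ‖k‖ = ‖a‖ := by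
  let B : Subalgebra ℝ A := Subalgebra.centralizer ℝ (Set.range j)
  have hB : ∀ x : A, x ∈ B ↔ ∀ z, j z * x = x * j z := by
    intro x
    simp [B, Subalgebra.mem_centralizer_iff]
  have hjB : ∀ z, j z ∈ B := fun z ↦ (hB _).2 fun w ↦ by
    rw [← map_mul, ← map_mul, mul_comm]
  let f : ℂ →+* B := (j.codRestrict B hjB).toRingHom
  let : Algebra ℂ B := f.toAlgebra' fun c x ↦ Subtype.ext ((hB x).1 x.2 c)
  let : NormedAlgebra ℂ B :=
    { norm_smul_le := fun c x ↦ by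
        rw [Algebra.smul_def]
        exact (norm_mul_le _ _).trans_eq (congrArg (· * ‖x‖) (hj c)) }
  have hclosed : IsClosed (B : Set A) := Set.isClosed_centralizer _
  have : CompleteSpace B := hclosed.completeSpace_coe
  let x : B := ⟨a, (hB a).2 fun z ↦ (ha z).symm⟩
  obtain ⟨k, hk, hkn⟩ := exists_mem_spectrum_norm_eq x hpow
  refine ⟨k, fun hu ↦ hk ?_, hkn⟩
  obtain ⟨u, hu⟩ := hu
  have hinv : (↑u⁻¹ : A) ∈ B := (hB _).2 fun z ↦ by
    have hcomm : Commute (j z) (u : A) := by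
      rw [hu]
      exact Commute.sub_right ((hB _).1 (hjB k) z) (ha z).symm
    exact hcomm.units_inv_right
  refine ⟨⟨algebraMap ℂ B k - x, ⟨↑u⁻¹, hinv⟩, Subtype.ext ?_, Subtype.ext ?_⟩, rfl⟩
  · change (j k - a) * ↑u⁻¹ = 1
    rw [← hu, Units.mul_inv]
  · change ↑u⁻¹ * (j k - a) = 1
    rw [← hu, Units.inv_mul]

theorem Quaternion.norm_coeComplex (z : ℂ) : ‖(z : ℍ)‖ = ‖z‖ := by
  rw [← sq_eq_sq₀ (norm_nonneg _) (norm_nonneg _), sq, ← Quaternion.normSq_eq_norm_mul_self,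
    Quaternion.normSq_def', ← Complex.normSq_eq_norm_sq, Complex.normSq_apply]
  simp
  ring

section

variable {A : Type*} [NormedRing A] [NormedAlgebra ℝ A] (φ : ℍ →ₐ[ℝ] A)

theorem isUnit_map_sub_of_norm_lt [CompleteSpace A] (hφ : ∀ z : ℍ, ‖φ z‖ = ‖z‖) {w : ℍ} {y : A}
    (h : ‖y‖ < ‖w‖) : IsUnit (φ w - y) := by
  have hw : w ≠ 0 := norm_pos_iff.1 ((norm_nonneg y).trans_lt h)
  have hw' : φ w * φ w⁻¹ = 1 := by rw [← map_mul, mul_inv_cancel₀ hw, map_one]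
  have heq : φ w - y = φ w * (1 - φ w⁻¹ * y) := by
    rw [mul_sub, mul_one, ← mul_assoc, hw', one_mul]
  rw [heq]
  refine ((isUnit_iff_ne_zero.2 hw).map φ).mul (isUnit_one_sub_of_norm_lt_one ?_)
  refine (norm_mul_le _ _).trans_lt ?_
  rwa [hφ, norm_inv, inv_mul_lt_one₀ (norm_pos_iff.2 hw)]

theorem norm_le_of_mem_qSpectrum [CompleteSpace A] (hφ : ∀ z : ℍ, ‖φ z‖ = ‖z‖) {a : A} {z : ℍ}
    (hz : z ∈ qSpectrum φ a) : ‖z‖ ≤ ‖a‖ :=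
  not_lt.1 fun h ↦ hz (isUnit_map_sub_of_norm_lt φ hφ h)

theorem isCompact_qSpectrum [CompleteSpace A] (hφ : ∀ z : ℍ, ‖φ z‖ = ‖z‖) (a : A) :
    IsCompact (qSpectrum φ a) := by
  have hcont : Continuous φ := (AddMonoidHomClass.isometry_of_norm φ hφ).continuous
  refine Metric.isCompact_of_isClosed_isBounded ?_ ?_
  · exact (Units.isOpen.preimage (hcont.sub continuous_const)).isClosed_compl
  · exact isBounded_iff_forall_norm_le.2 ⟨‖a‖, fun z hz ↦ norm_le_of_mem_qSpectrum φ hφ hz⟩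

/-- An element commuting with all quaternion scalars is selfadjoint, under the
quasicommutativity hypothesis. -/
theorem star_eq_of_commute_scalars [StarRing A]
    (hφstar : ∀ z : ℍ, φ (star z) = star (φ z))
    (hquasi : ∀ x : A, star x = x → ∀ a : ℍ, x * φ a = φ a * x)
    {a : A} (ha : ∀ z : ℍ, a * φ z = φ z * a) : star a = a := by
  have hsa : ∀ z, star a * φ z = φ z * star a := fun z ↦ by
    have h := congrArg star (ha (star z))
    rw [star_mul, star_mul, ← hφstar, star_star] at h
    exact h.symm
  set b := a - star a with hb
  have hcomm : ∀ z, b * φ z = φ z * b := fun z ↦ by rw [hb, sub_mul, mul_sub, ha, hsa]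
  obtain ⟨i, hi0, hi1, hi2, hi3⟩ : ∃ i : ℍ, i.re = 0 ∧ i.imI = 1 ∧ i.imJ = 0 ∧ i.imK = 0 :=
    ⟨⟨0, 1, 0, 0⟩, rfl, rfl, rfl, rfl⟩
  obtain ⟨j, hj0, hj1, hj2, hj3⟩ : ∃ j : ℍ, j.re = 0 ∧ j.imI = 0 ∧ j.imJ = 1 ∧ j.imK = 0 :=
    ⟨⟨0, 0, 1, 0⟩, rfl, rfl, rfl, rfl⟩
  have hi : star i = -i := by ext <;> simp [hi0]
  have hij : i * j - j * i ≠ 0 := fun h ↦ by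
    have := congrArg QuaternionAlgebra.imK h
    rw [Quaternion.imK_sub, Quaternion.imK_mul, Quaternion.imK_mul, hi0, hi1, hi2, hi3, hj0, hj1,
      hj2, hj3, Quaternion.imK_zero] at this
    norm_num at this
  have hstar : star (φ i * b) = φ i * b := by
    rw [star_mul, ← hφstar, hi, hb, star_sub, star_star, ← neg_sub a, map_neg, neg_mul_neg]
    exact hcomm i
  have h := hquasi _ hstar j
  have h0 : φ (i * j - j * i) * b = 0 := by
    rw [map_sub, map_mul, map_mul, sub_mul, mul_assoc, ← hcomm j, ← mul_assoc, h, mul_assoc,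
      sub_self]
  have hu : IsUnit (φ (i * j - j * i)) := (isUnit_iff_ne_zero.2 hij).map φ
  exact (sub_eq_zero.1 (hu.mul_right_eq_zero.1 h0)).symm

/-- The spectrum of a selfadjoint element commuting with all quaternion scalars is real. -/
theorem exists_real_of_mem_qSpectrum [CompleteSpace A] [StarRing A]
    (hφ : ∀ z : ℍ, ‖φ z‖ = ‖z‖)
    (hCstar : ∀ x : A, ‖star x * x‖ = ‖x‖ ^ 2)
    (hφstar : ∀ z : ℍ, φ (star z) = star (φ z))
    {a : A} (ha : ∀ z : ℍ, a * φ z = φ z * a) (hsa : star a = a) {z : ℍ}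
    (hz : z ∈ qSpectrum φ a) : ∃ r : ℝ, z = algebraMap ℝ ℍ r := by
  by_contra hne
  set q := z.im with hq
  have hzq : z = algebraMap ℝ ℍ z.re + q := (Quaternion.re_add_im z).symm
  have hq0 : 0 < ‖q‖ := norm_pos_iff.2 fun h ↦ hne ⟨z.re, by rw [h, add_zero] at hzq; exact hzq⟩
  have hstarq : star q = -q := by ext <;> simp [hq]
  have hqq : star q * q = algebraMap ℝ ℍ (‖q‖ ^ 2) := by
    rw [Quaternion.star_mul_self, Quaternion.normSq_eq_norm_mul_self, sq]; rfl
  set b := a - φ (algebraMap ℝ ℍ z.re) with hb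
  have hsb : star b = b := by
    rw [hb, star_sub, hsa, ← hφstar]
    congr 2
    exact Quaternion.star_coe _
  have hcomm : ∀ w, b * φ w = φ w * b := fun w ↦ by
    rw [hb, sub_mul, mul_sub, ha, ← map_mul, ← map_mul, Algebra.commutes]
  obtain ⟨t, ht0, ht⟩ : ∃ t : ℝ, 0 ≤ t ∧ ‖b‖ ^ 2 < (1 + 2 * t) * ‖q‖ ^ 2 := by
    refine ⟨‖b‖ ^ 2 / ‖q‖ ^ 2, by positivity, ?_⟩
    have : ‖b‖ ^ 2 / ‖q‖ ^ 2 * ‖q‖ ^ 2 = ‖b‖ ^ 2 := by field_simp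
    nlinarith [sq_nonneg ‖b‖, pow_pos hq0 2]
  have hstar : star (b + φ (t • q)) = b - φ (t • q) := by
    rw [star_add, hsb, ← hφstar, Quaternion.star_smul, hstarq, smul_neg, map_neg, sub_eq_add_neg]
  have hprod : star (b + φ (t • q)) * (b + φ (t • q)) = b * b + φ (star (t • q) * (t • q)) := by
    rw [hstar, map_mul, Quaternion.star_smul, hstarq, smul_neg, map_neg]
    simp only [sub_mul, mul_add, hcomm, neg_mul]
    abel
  have hnorm : ‖b + φ (t • q)‖ ^ 2 ≤ ‖b‖ ^ 2 + t ^ 2 * ‖q‖ ^ 2 := by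
    rw [← hCstar, hprod]
    refine (norm_add_le _ _).trans (add_le_add ?_ (le_of_eq ?_))
    · rw [sq]; exact norm_mul_le _ _
    · rw [hφ, norm_mul, norm_star, norm_smul, Real.norm_of_nonneg ht0]; ring
  have hlt : ‖b + φ (t • q)‖ < ‖(1 + t) • q‖ := by
    refine lt_of_pow_lt_pow_left₀ 2 (norm_nonneg _) ?_
    rw [norm_smul, Real.norm_of_nonneg (by linarith)]
    nlinarith
  refine hz ?_
  have heq : φ z - a = φ ((1 + t) • q) - (b + φ (t • q)) := by
    conv_lhs => rw [hzq]
    rw [hb, add_smul, one_smul, map_add, map_add]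
    abel
  rw [heq]
  exact isUnit_map_sub_of_norm_lt φ hφ hlt

/-- A selfadjoint element commuting with all quaternion scalars has `‖a‖` or `-‖a‖` in its
spectrum. -/
theorem norm_or_neg_norm_mem_qSpectrum [CompleteSpace A] [NormOneClass A] [StarRing A]
    (hφ : ∀ z : ℍ, ‖φ z‖ = ‖z‖)
    (hCstar : ∀ x : A, ‖star x * x‖ = ‖x‖ ^ 2)
    (hφstar : ∀ z : ℍ, φ (star z) = star (φ z))
    {a : A} (ha : ∀ z : ℍ, a * φ z = φ z * a) (hsa : star a = a) :
    algebraMap ℝ ℍ ‖a‖ ∈ qSpectrum φ a ∨ algebraMap ℝ ℍ (-‖a‖) ∈ qSpectrum φ a := by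
  have : Nontrivial A := NormOneClass.nontrivial
  have : CStarRing A := ⟨fun x ↦ by rw [hCstar, sq]⟩
  have hsa' : IsSelfAdjoint a := hsa
  obtain ⟨k, hk, hkn⟩ := exists_not_isUnit_sub_norm_eq (φ.comp Quaternion.ofComplex)
    (fun z ↦ (hφ _).trans (Quaternion.norm_coeComplex z)) a (fun z ↦ ha _)
    hsa'.nnnorm_pow_two_pow
  have hk' : (k : ℍ) ∈ qSpectrum φ a := hk
  obtain ⟨r, hr⟩ := exists_real_of_mem_qSpectrum φ hφ hCstar hφstar ha hsa hk'
  rw [hr] at hk'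
  have hrn : |r| = ‖a‖ := by
    rw [← hkn, ← Quaternion.norm_coeComplex, hr, norm_algebraMap', Real.norm_eq_abs]
  rcases abs_choice r with h | h
  · left; rwa [← hrn, h]
  · right; rwa [← hrn, h, neg_neg]

end

/-- In a C*-algebra over ℍ satisfying the quasicommutativity hypothesis, for an
element `a` commuting with all quaternion scalars: (i) if `a` is normal then
`r(a) = ‖a‖`; (ii) if `a` is selfadjoint then `σ(a)` is a nonempty compact set of
real quaternions containing `‖a‖` or `−‖a‖`; (iii) if `a` is unitary then
`‖a‖ = 1` and `σ(a)` lies in the unit sphere. -/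
theorem stmt_11 {A : Type*} [NormedRing A] [NormedAlgebra ℝ A] [CompleteSpace A]
    [NormOneClass A] [StarRing A]
    (φ : ℍ →ₐ[ℝ] A) (hφ : ∀ z : ℍ, ‖φ z‖ = ‖z‖)
    (hCstar : ∀ x : A, ‖star x * x‖ = ‖x‖ ^ 2)
    (hφstar : ∀ z : ℍ, φ (star z) = star (φ z))
    (hquasi : ∀ x : A, star x = x → ∀ a : ℍ, x * φ a = φ a * x)
    (a : A) (ha : ∀ z : ℍ, a * φ z = φ z * a) :
    (star a * a = a * star a → qSpectralRadius φ a = ‖a‖) ∧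
    (star a = a →
      (qSpectrum φ a).Nonempty ∧ IsCompact (qSpectrum φ a) ∧
      (∀ z ∈ qSpectrum φ a, ∃ r : ℝ, z = algebraMap ℝ ℍ r) ∧
      (algebraMap ℝ ℍ ‖a‖ ∈ qSpectrum φ a ∨ algebraMap ℝ ℍ (-‖a‖) ∈ qSpectrum φ a)) ∧
    (star a * a = 1 ∧ a * star a = 1 →
      ‖a‖ = 1 ∧ qSpectrum φ a ⊆ {z : ℍ | ‖z‖ = 1}) := by
  have hsa := star_eq_of_commute_scalars φ hφstar hquasi ha
  have hreal := fun z hz ↦ exists_real_of_mem_qSpectrum φ hφ hCstar hφstar ha hsa (z := z) hz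
  have hmem := norm_or_neg_norm_mem_qSpectrum φ hφ hCstar hφstar ha hsa
  refine ⟨fun _ ↦ IsGreatest.csSup_eq ⟨?_, ?_⟩, fun _ ↦ ⟨?_, isCompact_qSpectrum φ hφ a, hreal, hmem⟩,
    fun ⟨h1, _⟩ ↦ ⟨?_, fun z hz ↦ ?_⟩⟩
  · rcases hmem with h | h
    · exact ⟨_, h, by rw [norm_algebraMap', norm_norm]⟩
    · exact ⟨_, h, by rw [norm_algebraMap', norm_neg, norm_norm]⟩
  · rintro _ ⟨z, hz, rfl⟩
    exact norm_le_of_mem_qSpectrum φ hφ hz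
  · exact hmem.elim (fun h ↦ ⟨_, h⟩) fun h ↦ ⟨_, h⟩
  · have h := hCstar a
    rw [h1, norm_one] at h
    exact (pow_eq_one_iff_of_nonneg (norm_nonneg a) two_ne_zero).1 h.symm
  · rw [hsa] at h1
    by_contra hne
    have hz2 : z * z - 1 ≠ 0 := fun h ↦ hne <| by
      have h2 := congrArg norm (sub_eq_zero.1 h)
      rw [norm_mul, norm_one, ← sq] at h2
      exact (pow_eq_one_iff_of_nonneg (norm_nonneg z) two_ne_zero).1 h2
    have hcomm : Commute (φ z - a) (φ z + a) := by
      have hc : Commute (φ z) a := (ha z).symm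
      exact ((Commute.refl _).add_right hc).sub_left (hc.symm.add_right (Commute.refl _))
    have heq : (φ z - a) * (φ z + a) = φ (z * z - 1) := by
      rw [map_sub, map_mul, map_one, ← h1, sub_mul, mul_add, mul_add, ha]
      abel
    have hu : IsUnit ((φ z - a) * (φ z + a)) := heq ▸ (isUnit_iff_ne_zero.2 hz2).map φ
    exact hz (hcomm.isUnit_mul_iff.1 hu).1
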